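/- Let I be a Set Cover instance with universe U = {u_1, ..., u_nu} (nu >= 1) and collection of subsets S = {S_1, ..., S_mu} whose union is U, let x be any set cover of U from S, and let I' be the MDST instance produced from I by the forward mapping. Then there exists a spanning tree T of the graph of I' with dissipation cost C(T) <= 2 * mu^2 * |x|^2; concretely, the subgraph consisting of the edge {y,z}, the edges {y, s_{i,ell}} for all ell and all i with S_i not in x, the edges {z, s_{i,ell}} for all ell and all i with S_i in x, and, for a fixed choice function g: U -> x assigning each element u_j a subset g(u_j) in x containing it, the edges {s_{i,ell}, u_{j,ell}} for all ell and all j with S_i = g(u_j), is a spanning tree with this cost bound. -/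

import Mathlib

open SimpleGraph
open scoped Classical

/-- `T` is a spanning tree of `G`: a subgraph of `G` (on the full node set) that is
connected and contains no cycles, i.e. is a tree. -/
def IsSpanningTreeOf {V : Type*} (G T : SimpleGraph V) : Prop :=
  T ≤ G ∧ T.IsTree

/-- In the tree `T` rooted at `n0`, a node `u` is *downward* of the edge `e` if every
path in `T` from the root `n0` to `u` uses the edge `e` (in a tree the path is unique). -/
def Downward {V : Type*} (T : SimpleGraph V) (n0 : V) (e : Sym2 V) (u : V) : Prop :=
  ∀ p : T.Walk n0 u, p.IsPath → e ∈ p.edges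

/-- `(n, m)` is an edge of `T` oriented away from the root `n0`, with tail `n` and
head `m`. -/
def OrientedEdge {V : Type*} (T : SimpleGraph V) (n0 : V) (n m : V) : Prop :=
  T.Adj n m ∧ Downward T n0 s(n, m) m

/-- The flow on the oriented tree edge `(a, b)` determined by Kirchhoff's current law:
the sum of the demands over all nodes downward of the edge. -/
noncomputable def edgeFlow {V : Type*} [Fintype V] (T : SimpleGraph V) (n0 : V)
    (f : V → ℝ) (a b : V) : ℝ :=
  ∑ u : V, if Downward T n0 s(a, b) u then f u else 0

/-- The dissipation cost `C(T) = ∑_{e ∈ T} α_e f_e(T)^2` of the spanning tree `T`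
(each tree edge taken with its unique orientation away from the root `n0`, which does
not affect the squared flows). -/
noncomputable def treeCost {V : Type*} [Fintype V] (T : SimpleGraph V) (n0 : V)
    (f : V → ℝ) (α : Sym2 V → ℝ) : ℝ :=
  ∑ p : V × V,
    if OrientedEdge T n0 p.1 p.2 then α s(p.1, p.2) * (edgeFlow T n0 f p.1 p.2) ^ 2
    else 0

/-- The node set of the forward mapping: the two source nodes `y, z` (encoded as
`Fin 2`), the nodes `s_{i,ℓ}` for `i, ℓ ∈ {1,…,μ}`, and the nodes `u_{j,ℓ}` for
`j ∈ {1,…,ν}`, `ℓ ∈ {1,…,μ}`. -/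
abbrev SCNode (ν μ : ℕ) := Fin 2 ⊕ ((Fin μ × Fin μ) ⊕ (Fin ν × Fin μ))

def yNode (ν μ : ℕ) : SCNode ν μ := Sum.inl 0
def zNode (ν μ : ℕ) : SCNode ν μ := Sum.inl 1
def sNode (ν μ : ℕ) (i l : Fin μ) : SCNode ν μ := Sum.inr (Sum.inl (i, l))
def uNode (ν μ : ℕ) (j : Fin ν) (l : Fin μ) : SCNode ν μ := Sum.inr (Sum.inr (j, l))

/-- The edges of the forward mapping: `{y,z}`; `{y, s_{i,ℓ}}` and `{z, s_{i,ℓ}}` for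
all `i, ℓ`; and `{s_{i,ℓ}, u_{j,ℓ}}` whenever `u_j ∈ S_i`. -/
def scEdges (ν μ : ℕ) (Sets : Fin μ → Finset (Fin ν)) : Set (Sym2 (SCNode ν μ)) :=
  {s(yNode ν μ, zNode ν μ)} ∪
  {e | ∃ i l, e = s(yNode ν μ, sNode ν μ i l) ∨ e = s(zNode ν μ, sNode ν μ i l)} ∪
  {e | ∃ i l j, j ∈ Sets i ∧ e = s(sNode ν μ i l, uNode ν μ j l)}

/-- The graph `G` of the MDST instance produced by the forward mapping. -/
def scGraph (ν μ : ℕ) (Sets : Fin μ → Finset (Fin ν)) : SimpleGraph (SCNode ν μ) :=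
  SimpleGraph.fromEdgeSet (scEdges ν μ Sets)

/-- The demands of the forward mapping: `f_y = -μ²`, `f_z = -ν μ³`, `f_v = 1` for
`v ∈ V_S`, and `f_v = μ²` for `v ∈ V_U`. -/
noncomputable def scDemand (ν μ : ℕ) : SCNode ν μ → ℝ
  | Sum.inl i => if i = 0 then -((μ : ℝ) ^ 2) else -((ν : ℝ) * (μ : ℝ) ^ 3)
  | Sum.inr (Sum.inl _) => 1
  | Sum.inr (Sum.inr _) => (μ : ℝ) ^ 2

/-- The dissipation constants of the forward mapping: `α_e = 1` for edges incident to
`y`, and `α_e = 0` otherwise. -/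
noncomputable def scAlpha (ν μ : ℕ) (e : Sym2 (SCNode ν μ)) : ℝ :=
  if yNode ν μ ∈ e then 1 else 0

/-- The cost of a solution (spanning tree) `T` of the MDST instance produced by the
forward mapping. -/
noncomputable def scCost (ν μ : ℕ) (T : SimpleGraph (SCNode ν μ)) : ℝ :=
  treeCost T (yNode ν μ) (scDemand ν μ) (scAlpha ν μ)

/-- The node `v` has degree at least `2` in the graph `T`. -/
def DegTwo {W : Type*} (T : SimpleGraph W) (v : W) : Prop :=
  2 ≤ {w | T.Adj v w}.ncard

/-- The witness spanning tree built from a set cover `x` and a choice function `g`: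
its edges are `{y,z}`; `{y, s_{i,ℓ}}` for all `ℓ` and all `i` with `S_i ∉ x`;
`{z, s_{i,ℓ}}` for all `ℓ` and all `i` with `S_i ∈ x`; and `{s_{g(u_j),ℓ}, u_{j,ℓ}}`
for all `ℓ` and `j`. -/
def witnessTree (ν μ : ℕ) (x : Finset (Fin μ)) (g : Fin ν → Fin μ) :
    SimpleGraph (SCNode ν μ) :=
  SimpleGraph.fromEdgeSet
    ({s(yNode ν μ, zNode ν μ)} ∪
      {e | ∃ l i, i ∉ x ∧ e = s(yNode ν μ, sNode ν μ i l)} ∪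
      {e | ∃ l i, i ∈ x ∧ e = s(zNode ν μ, sNode ν μ i l)} ∪
      {e | ∃ l j, e = s(sNode ν μ (g j) l, uNode ν μ j l)})

/-- A predicate invariant under graph adjacency is also invariant under reachability. -/
theorem SimpleGraph.Reachable.iff_of_forall_adj {V : Type*} {H : SimpleGraph V} {S : V → Prop}
    (hS : ∀ a b, H.Adj a b → (S a ↔ S b)) {a b : V} (h : H.Reachable a b) :
    S a ↔ S b := by
  obtain ⟨p⟩ := h
  induction p with
  | nil => rfl
  | cons hab _ ih => exact (hS _ _ hab).trans ih

theorem downward_iff_not_reachable {V : Type*} (T : SimpleGraph V) (r : V) (e : Sym2 V)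
    (u : V) : Downward T r e u ↔ ¬ (T.deleteEdges {e}).Reachable r u := by
  constructor
  · rintro h ⟨p⟩
    have hle : T.deleteEdges {e} ≤ T := T.deleteEdges_le {e}
    have he := h (p.toPath.1.mapLe hle) (p.toPath.2.mapLe hle)
    rw [Walk.edges_mapLe_eq_edges] at he
    have := p.toPath.1.edges_subset_edgeSet he
    simp [edgeSet_deleteEdges] at this
  · intro h p _
    by_contra he
    exact h ⟨p.toDeleteEdge e he⟩

/-- The edges of the witness tree, oriented from parent to child. -/
inductive WitnessArc {ν μ : ℕ} (x : Finset (Fin μ)) (g : Fin ν → Fin μ) :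
    SCNode ν μ → SCNode ν μ → Prop
  | yz : WitnessArc x g (yNode ν μ) (zNode ν μ)
  | ys (i l : Fin μ) (hi : i ∉ x) : WitnessArc x g (yNode ν μ) (sNode ν μ i l)
  | zs (i l : Fin μ) (hi : i ∈ x) : WitnessArc x g (zNode ν μ) (sNode ν μ i l)
  | su (j : Fin ν) (l : Fin μ) : WitnessArc x g (sNode ν μ (g j) l) (uNode ν μ j l)

section witness

variable {ν μ : ℕ} {x : Finset (Fin μ)} {g : Fin ν → Fin μ}

theorem WitnessArc.adj {a b : SCNode ν μ} (h : WitnessArc x g a b) :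
    (witnessTree ν μ x g).Adj a b := by
  cases h <;> simp_all [witnessTree, yNode, zNode, sNode, uNode]

theorem witnessTree_adj_iff (a b : SCNode ν μ) :
    (witnessTree ν μ x g).Adj a b ↔ WitnessArc x g a b ∨ WitnessArc x g b a := by
  constructor
  · intro h
    simp only [witnessTree, fromEdgeSet_adj, Set.mem_union, Set.mem_singleton_iff,
      Set.mem_ofPred_eq, Sym2.eq_iff] at h
    obtain ⟨((h | ⟨l, i, hi, h⟩) | ⟨l, i, hi, h⟩) | ⟨l, j, h⟩, -⟩ := h <;>
      obtain ⟨rfl, rfl⟩ | ⟨rfl, rfl⟩ := h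
    exacts [.inl .yz, .inr .yz, .inl (.ys i l hi), .inr (.ys i l hi), .inl (.zs i l hi),
      .inr (.zs i l hi), .inl (.su j l), .inr (.su j l)]
  · rintro (h | h)
    exacts [h.adj, h.adj.symm]

/-- If all arcs other than `e` preserve `S`, then so does reachability after deleting `e`. -/
theorem iff_of_reachable_deleteEdges {e : Sym2 (SCNode ν μ)} {S : SCNode ν μ → Prop}
    (hS : ∀ a b, WitnessArc x g a b → s(a, b) ≠ e → (S a ↔ S b)) {a b : SCNode ν μ}
    (h : ((witnessTree ν μ x g).deleteEdges {e}).Reachable a b) : S a ↔ S b := by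
  refine h.iff_of_forall_adj fun c d hcd => ?_
  rw [deleteEdges_adj, witnessTree_adj_iff, Set.mem_singleton_iff] at hcd
  obtain ⟨h | h, hne⟩ := hcd
  · exact hS _ _ h hne
  · exact (hS _ _ h (by rwa [Sym2.eq_swap])).symm

theorem WitnessArc.reachable_deleteEdges {e : Sym2 (SCNode ν μ)} {a b : SCNode ν μ}
    (h : WitnessArc x g a b) (hne : s(a, b) ≠ e) :
    ((witnessTree ν μ x g).deleteEdges {e}).Reachable a b :=
  Adj.reachable (by simpa [deleteEdges_adj] using ⟨h.adj, hne⟩)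

/-- Membership in the nodes of the witness tree below the edge `{y, z}`. -/
def belowZ (ν : ℕ) {μ : ℕ} (x : Finset (Fin μ)) : SCNode ν μ → Prop
  | Sum.inl i => i = 1
  | Sum.inr (Sum.inl (i, _)) => i ∈ x
  | Sum.inr (Sum.inr _) => True

/-- Membership in the nodes of the witness tree at or below `s_{i,ℓ}`. -/
def belowS (g : Fin ν → Fin μ) (i l : Fin μ) : SCNode ν μ → Prop
  | Sum.inl _ => False
  | Sum.inr (Sum.inl (i', l')) => i' = i ∧ l' = l
  | Sum.inr (Sum.inr (j, l')) => g j = i ∧ l' = l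

theorem belowZ_arc (hg : ∀ j, g j ∈ x) (a b : SCNode ν μ) (h : WitnessArc x g a b)
    (hne : s(a, b) ≠ s(yNode ν μ, zNode ν μ)) : belowZ ν x a ↔ belowZ ν x b := by
  cases h <;> simp_all [belowZ, yNode, zNode, sNode, uNode]

theorem belowS_arc {p : SCNode ν μ} {i l : Fin μ} (hp : WitnessArc x g p (sNode ν μ i l))
    (a b : SCNode ν μ) (h : WitnessArc x g a b)
    (hne : s(a, b) ≠ s(p, sNode ν μ i l)) : belowS g i l a ↔ belowS g i l b := by
  cases hp <;> cases h <;>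
    simp_all [belowS, yNode, zNode, sNode, uNode] <;> grind

theorem WitnessArc.isBridge (hg : ∀ j, g j ∈ x) {a b : SCNode ν μ}
    (h : WitnessArc x g a b) : (witnessTree ν μ x g).IsBridge s(a, b) := by
  rw [isBridge_iff]
  intro hr
  change ((witnessTree ν μ x g).deleteEdges {s(a, b)}).Reachable a b at hr
  cases h with
  | yz =>
    have := iff_of_reachable_deleteEdges (belowZ_arc hg) hr
    simp [belowZ, yNode, zNode] at this
  | ys i l hi =>
    have := iff_of_reachable_deleteEdges (belowS_arc (.ys i l hi)) hr
    simp [belowS, yNode, sNode] at this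
  | zs i l hi =>
    have := iff_of_reachable_deleteEdges (belowS_arc (.zs i l hi)) hr
    simp [belowS, zNode, sNode] at this
  | su j l =>
    have := iff_of_reachable_deleteEdges (S := (· = uNode ν μ j l)) (fun a b h hne => by
      cases h <;> simp_all [yNode, zNode, sNode, uNode]
      grind) hr
    simp [sNode, uNode] at this

theorem witnessTree_isTree (hg : ∀ j, g j ∈ x) : (witnessTree ν μ x g).IsTree := by
  constructor
  · have hz : (witnessTree ν μ x g).Reachable (yNode ν μ) (zNode ν μ) :=
      WitnessArc.yz.adj.reachable
    have hs (i l : Fin μ) :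
        (witnessTree ν μ x g).Reachable (yNode ν μ) (sNode ν μ i l) := by
      by_cases hi : i ∈ x
      · exact hz.trans (WitnessArc.zs i l hi).adj.reachable
      · exact (WitnessArc.ys i l hi).adj.reachable
    rw [connected_iff_exists_forall_reachable]
    refine ⟨yNode ν μ, ?_⟩
    rintro (i | ⟨i, l⟩ | ⟨j, l⟩)
    · fin_cases i
      exacts [Reachable.refl _, hz]
    · exact hs i l
    · exact (hs (g j) l).trans (WitnessArc.su j l).adj.reachable
  · rw [isAcyclic_iff_forall_isBridge]
    intro e
    induction e with | h a b
    intro he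
    rw [mem_edgeSet, witnessTree_adj_iff] at he
    obtain h | h := he
    · exact h.isBridge hg
    · rw [Sym2.eq_swap]
      exact h.isBridge hg

theorem downward_yz_iff (hg : ∀ j, g j ∈ x) (u : SCNode ν μ) :
    Downward (witnessTree ν μ x g) (yNode ν μ) s(yNode ν μ, zNode ν μ) u ↔
      belowZ ν x u := by
  rw [downward_iff_not_reachable]
  constructor
  · contrapose!
    intro hu
    rcases u with i | ⟨i, l⟩ | ⟨j, l⟩
    · fin_cases i
      · exact Reachable.refl _
      · simp [belowZ] at hu
    · exact (WitnessArc.ys i l hu).reachable_deleteEdges (by simp [yNode, zNode, sNode])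
    · simp [belowZ] at hu
  · intro hu hr
    have := (iff_of_reachable_deleteEdges (belowZ_arc hg) hr).2 hu
    simp [belowZ, yNode] at this

theorem downward_ys_iff (hg : ∀ j, g j ∈ x) {i l : Fin μ} (hi : i ∉ x) (u : SCNode ν μ) :
    Downward (witnessTree ν μ x g) (yNode ν μ) s(yNode ν μ, sNode ν μ i l) u ↔
      u = sNode ν μ i l := by
  rw [downward_iff_not_reachable]
  constructor
  · contrapose!
    intro hu
    have hz : ((witnessTree ν μ x g).deleteEdges {s(yNode ν μ, sNode ν μ i l)}).Reachable
        (yNode ν μ) (zNode ν μ) :=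
      WitnessArc.yz.reachable_deleteEdges (by simp [yNode, zNode, sNode])
    have hzs (i' l' : Fin μ) (hi' : i' ∈ x) :=
      hz.trans ((WitnessArc.zs i' l' hi').reachable_deleteEdges
        (by simp [yNode, zNode, sNode]))
    rcases u with i' | ⟨i', l'⟩ | ⟨j, l'⟩
    · fin_cases i'
      exacts [Reachable.refl _, hz]
    · by_cases hi' : i' ∈ x
      · exact hzs i' l' hi'
      · refine (WitnessArc.ys i' l' hi').reachable_deleteEdges ?_
        simpa [yNode, sNode] using hu
    · exact (hzs (g j) l' (hg j)).trans ((WitnessArc.su j l').reachable_deleteEdges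
        (by simp [yNode, uNode, sNode]))
  · rintro rfl hr
    have := iff_of_reachable_deleteEdges (belowS_arc (.ys i l hi)) hr
    simp [belowS, yNode, sNode] at this

theorem edgeFlow_yz (hg : ∀ j, g j ∈ x) :
    edgeFlow (witnessTree ν μ x g) (yNode ν μ) (scDemand ν μ) (yNode ν μ) (zNode ν μ) =
      μ * x.card := by
  have hs (i l : Fin μ) : (if belowZ ν x (Sum.inr (Sum.inl (i, l))) then
      scDemand ν μ (Sum.inr (Sum.inl (i, l))) else 0) = if i ∈ x then (1 : ℝ) else 0 :=
    if_congr Iff.rfl rfl rfl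
  have hsum : ∑ i, ∑ _l : Fin μ, (if i ∈ x then (1 : ℝ) else 0) = μ * x.card := by
    rw [Finset.sum_comm]
    simp
  simp only [edgeFlow, downward_yz_iff hg, Fintype.sum_sum_type, Fin.sum_univ_two,
    Fintype.sum_prod_type, hs, hsum]
  simp [belowZ, scDemand]
  ring

theorem edgeFlow_ys (hg : ∀ j, g j ∈ x) {i l : Fin μ} (hi : i ∉ x) :
    edgeFlow (witnessTree ν μ x g) (yNode ν μ) (scDemand ν μ) (yNode ν μ)
      (sNode ν μ i l) = 1 := by
  simp only [edgeFlow, downward_ys_iff hg hi]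
  simp [scDemand, sNode]

theorem not_downward_root {V : Type*} (T : SimpleGraph V) (r : V) (e : Sym2 V) :
    ¬ Downward T r e r := by
  simp [downward_iff_not_reachable]

theorem scCost_eq_sum_y (T : SimpleGraph (SCNode ν μ)) :
    scCost ν μ T = ∑ b, if OrientedEdge T (yNode ν μ) (yNode ν μ) b then
      (edgeFlow T (yNode ν μ) (scDemand ν μ) (yNode ν μ) b) ^ 2 else 0 := by
  rw [scCost, treeCost, Fintype.sum_prod_type, Fintype.sum_eq_single (yNode ν μ)]
  · simp [scAlpha]
  · intro a ha
    refine Finset.sum_eq_zero fun b _ => ?_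
    split_ifs with h
    · have hb : yNode ν μ ≠ b := by
        rintro rfl
        exact not_downward_root _ _ _ h.2
      simp [scAlpha, ha.symm, hb]
    · rfl

theorem scCost_witnessTree (hg : ∀ j, g j ∈ x) :
    scCost ν μ (witnessTree ν μ x g) =
      (μ * x.card : ℝ) ^ 2 + μ * (μ - x.card : ℝ) := by
  have hy : ¬ OrientedEdge (witnessTree ν μ x g) (yNode ν μ) (yNode ν μ) (yNode ν μ) :=
    fun h => h.1.ne rfl
  have hz : OrientedEdge (witnessTree ν μ x g) (yNode ν μ) (yNode ν μ) (zNode ν μ) :=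
    ⟨WitnessArc.yz.adj, (downward_yz_iff hg _).2 (by simp [belowZ, zNode])⟩
  have hs (i l : Fin μ) : (if OrientedEdge (witnessTree ν μ x g) (yNode ν μ) (yNode ν μ)
      (sNode ν μ i l) then (edgeFlow (witnessTree ν μ x g) (yNode ν μ) (scDemand ν μ)
        (yNode ν μ) (sNode ν μ i l)) ^ 2 else 0) = 1 - if i ∈ x then (1 : ℝ) else 0 := by
    by_cases hi : i ∈ x
    · rw [if_neg]
      · simp [hi]
      · rintro ⟨h, -⟩
        rw [witnessTree_adj_iff] at h
        generalize ha : yNode ν μ = a at h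
        generalize hb : sNode ν μ i l = b at h
        obtain h | h := h <;> cases h <;> simp_all [yNode, zNode, sNode, uNode]
    · rw [if_pos ⟨(WitnessArc.ys i l hi).adj, (downward_ys_iff hg hi _).2 rfl⟩,
        edgeFlow_ys hg hi]
      simp [hi]
  have hu (j : Fin ν) (l : Fin μ) : ¬ OrientedEdge (witnessTree ν μ x g) (yNode ν μ)
      (yNode ν μ) (uNode ν μ j l) := by
    rintro ⟨h, -⟩
    rw [witnessTree_adj_iff] at h
    generalize ha : yNode ν μ = a at h
    generalize hb : uNode ν μ j l = b at h
    obtain h | h := h <;> cases h <;> simp_all [yNode, zNode, sNode, uNode]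
  rw [scCost_eq_sum_y]
  simp only [Fintype.sum_sum_type, Fin.sum_univ_two, Fintype.sum_prod_type]
  simp only [← yNode.eq_1, ← zNode.eq_1, ← sNode.eq_1, ← uNode.eq_1, hy, hz, hs, hu,
    if_true, if_false, edgeFlow_yz hg]
  simp
  ring

end witness

theorem witnessTree_le_scGraph {ν μ : ℕ} {Sets : Fin μ → Finset (Fin ν)}
    {x : Finset (Fin μ)} {g : Fin ν → Fin μ} (hg : ∀ j, j ∈ Sets (g j)) :
    witnessTree ν μ x g ≤ scGraph ν μ Sets := by
  refine fromEdgeSet_mono ?_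
  rintro e (((h | ⟨l, i, hi, h⟩) | ⟨l, i, hi, h⟩) | ⟨l, j, h⟩)
  · exact .inl (.inl h)
  · exact .inl (.inr ⟨i, l, .inl h⟩)
  · exact .inl (.inr ⟨i, l, .inr h⟩)
  · exact .inr ⟨g j, l, j, hg j, h⟩

/-- For any set cover `x` of a Set Cover instance and any choice
function `g` assigning to each element `u_j` a subset `g(u_j) ∈ x` containing it, the
witness subgraph is a spanning tree of the graph of the MDST instance produced by the
forward mapping, with dissipation cost at most `2 μ² |x|²`.  In particular, there
exists a spanning tree with this cost bound. -/
theorem stmt15 (ν μ : ℕ) (hν : 1 ≤ ν) (Sets : Fin μ → Finset (Fin ν))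
    (hcover : ∀ j : Fin ν, ∃ i : Fin μ, j ∈ Sets i)
    (x : Finset (Fin μ)) (hx : ∀ j : Fin ν, ∃ i ∈ x, j ∈ Sets i)
    (g : Fin ν → Fin μ) (hg : ∀ j : Fin ν, g j ∈ x ∧ j ∈ Sets (g j)) :
    IsSpanningTreeOf (scGraph ν μ Sets) (witnessTree ν μ x g) ∧
      scCost ν μ (witnessTree ν μ x g) ≤ 2 * (μ : ℝ) ^ 2 * (x.card : ℝ) ^ 2 := by
  have hgx : ∀ j, g j ∈ x := fun j => (hg j).1
  refine ⟨⟨witnessTree_le_scGraph fun j => (hg j).2, witnessTree_isTree hgx⟩, ?_⟩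
  rw [scCost_witnessTree hgx]
  have hx1 : (1 : ℝ) ≤ x.card := by
    exact_mod_cast Finset.card_pos.2 ⟨g ⟨0, hν⟩, hgx _⟩
  have hμ : (0 : ℝ) ≤ μ := Nat.cast_nonneg μ
  have hsq : (1 : ℝ) ≤ (x.card : ℝ) ^ 2 := one_le_pow₀ hx1
  nlinarith [mul_le_mul_of_nonneg_left hsq (sq_nonneg (μ : ℝ)),
    mul_nonneg hμ (zero_le_one.trans hx1)]
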